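/- Let ψ be a homeomorphism from an open interval U ⊂ ℝ onto ψ(U) ⊂ ℝ, and let a < b < c < d be reals with [a,d] ⊂ U ∩ ψ(U) such that: (1) ψ²([a,b]) ⊂ (b,c); (2) ψ^{-1}([b,c]) ⊂ (a,c); (3) ψ^{-2}([c,d]) ⊂ (b,c); (4) ψ([b,c]) ⊂ (b,d) (all compositions being defined on the indicated sets). Call a finite word w ∈ {0,1}^n admissible if there exists x ∈ [b,c] such that the partial orbit x₀ = x, x_{j+1} = ψ(x_j) if w_j = 0 and x_{j+1} = ψ^{-1}(x_j) if w_j = 1, is defined and satisfies x_j ∈ [a,d] for all 0 ≤ j ≤ n. Then for every n ∈ ℕ the number of admissible words of length n is at least 2^{⌊n/3⌋}. -/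

import Mathlib

/-- The binary word `s 0, ¬ s 0, s 1, ¬ s 1, …` of length `n`, with `s` extended by `false`. -/
def alternatingWord (m n : ℕ) (s : Fin m → Bool) (j : Fin n) : Bool :=
  let t : Bool := if h : (j : ℕ) / 2 < m then s ⟨(j : ℕ) / 2, h⟩ else false
  if (j : ℕ) % 2 = 0 then t else !t

theorem alternatingWord_injective {m n : ℕ} (h : 2 * m ≤ n) :
    Function.Injective (alternatingWord m n) := by
  intro s t hst
  funext k
  have hk := congrFun hst ⟨2 * (k : ℕ), by omega⟩
  simpa [alternatingWord] using hk

/-- Exponential growth of admissible words for the iterated function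
system generated by `ψ, ψ⁻¹`.  Let `ψ` be a homeomorphism from an open interval `U` onto
`ψ(U)` and `a < b < c < d` with `[a,d] ⊆ U ∩ ψ(U)`, such that `ψ²([a,b]) ⊂ (b,c)`,
`ψ⁻¹([b,c]) ⊂ (a,c)`, `ψ⁻²([c,d]) ⊂ (b,c)`, `ψ([b,c]) ⊂ (b,d)`.  A word
`w ∈ {0,1}ⁿ` is admissible if some partial orbit starting in `[b,c]`, applying `ψ` for
the symbol `0` and `ψ⁻¹` for the symbol `1`, is defined and stays in `[a,d]`.  Then the
number of admissible words of length `n` is at least `2^⌊n/3⌋`. -/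
theorem admissible_words_exponential_growth
    (U : Set ℝ) (hUopen : IsOpen U) (hUconn : U.OrdConnected)
    (ψ ψinv : ℝ → ℝ)
    (hψcont : ContinuousOn ψ U) (hψinvcont : ContinuousOn ψinv (ψ '' U))
    (hleft : ∀ x ∈ U, ψinv (ψ x) = x) (hright : ∀ y ∈ ψ '' U, ψ (ψinv y) = y)
    (a b c d : ℝ) (hab : a < b) (hbc : b < c) (hcd : c < d)
    (had : Set.Icc a d ⊆ U ∩ ψ '' U)
    (h1 : ∀ x ∈ Set.Icc a b, ψ x ∈ U ∧ ψ (ψ x) ∈ Set.Ioo b c)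
    (h2 : ∀ x ∈ Set.Icc b c, ψinv x ∈ Set.Ioo a c)
    (h3 : ∀ x ∈ Set.Icc c d, ψinv x ∈ ψ '' U ∧ ψinv (ψinv x) ∈ Set.Ioo b c)
    (h4 : ∀ x ∈ Set.Icc b c, ψ x ∈ Set.Ioo b d) :
    ∀ n : ℕ,
      2 ^ (n / 3) ≤
        Set.ncard {w : Fin n → Bool |
          ∃ x : ℕ → ℝ,
            x 0 ∈ Set.Icc b c ∧ (∀ j ≤ n, x j ∈ Set.Icc a d) ∧
            ∀ j : Fin n,
              (w j = false → x j ∈ U ∧ x (j + 1) = ψ (x j)) ∧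
              (w j = true → x j ∈ ψ '' U ∧ x (j + 1) = ψinv (x j))} := by
  intro n
  have hinj : Function.Injective (alternatingWord (n / 3) n) :=
    alternatingWord_injective (by omega)
  have hcard : (Set.range (alternatingWord (n / 3) n)).ncard = 2 ^ (n / 3) := by
    rw [← Set.image_univ, Set.ncard_image_of_injective _ hinj, Set.ncard_univ]
    simp
  rw [← hcard]
  refine Set.ncard_le_ncard ?_ (Set.toFinite _)
  rintro _ ⟨s, rfl⟩
  have hb : b ∈ Set.Icc b c := ⟨le_rfl, hbc.le⟩
  have hbad : b ∈ Set.Icc a d := ⟨hab.le, (hbc.trans hcd).le⟩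
  obtain ⟨hbU, hbV⟩ := had hbad
  have hfwd : ψ b ∈ Set.Icc a d := ⟨(hab.trans (h4 b hb).1).le, (h4 b hb).2.le⟩
  have hbwd : ψinv b ∈ Set.Icc a d := ⟨(h2 b hb).1.le, ((h2 b hb).2.trans hcd).le⟩
  -- the orbit returns to `b` at every even time
  refine ⟨fun j => if j % 2 = 0 then b else
    if (if h : j / 2 < n / 3 then s ⟨j / 2, h⟩ else false) then ψinv b else ψ b,
    by simpa using hbc.le, ?_, ?_⟩
  · intro j _
    dsimp only
    split_ifs <;> assumption
  · intro j
    rcases Nat.mod_two_eq_zero_or_one (j : ℕ) with hj | hj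
    · have hj1 : ((j : ℕ) + 1) % 2 = 1 := by omega
      have hj2 : ((j : ℕ) + 1) / 2 = (j : ℕ) / 2 := by omega
      simp only [alternatingWord, hj, hj1, hj2]
      generalize (if h : (j : ℕ) / 2 < n / 3 then s ⟨(j : ℕ) / 2, h⟩ else false) = t
      cases t <;> simp [hbU] <;> simpa using hbV
    · have hj1 : ((j : ℕ) + 1) % 2 = 0 := by omega
      simp only [alternatingWord, hj, hj1]
      generalize (if h : (j : ℕ) / 2 < n / 3 then s ⟨(j : ℕ) / 2, h⟩ else false) = t
      cases t
      · simpa [hleft b hbU] using (had hfwd).2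
      · simpa [hright b hbV] using (had hbwd).1
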